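/- arXiv:1308.5014 — 2 statements merged into one kernel-verified Lean document; each statement's English description precedes it below -/
import Mathlib

section
/- Let (E, d) be a Bratteli diagram with levels W_n. Suppose that for every vertex v ∈ E⁰ there exists a vertex w ∈ E⁰ with v ≥ w and d(w) = Σ_{α ∈ W₁ E* w} d(s(α)). Then for every n ≥ 2 and every v ∈ W_n, d(v) = Σ_{e ∈ E¹v} d(s(e)). -/
/-- Paths in a directed graph with vertex set `V`, edge set `E`, source map `s` and
range map `r`.  `DPath s r u v` is the type of paths from `u` to `v`; the length-zero
path at `v` is `DPath.nil v`. -/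
inductive DPath {V E : Type} (s r : E → V) : V → V → Type
  | nil (v : V) : DPath s r v v
  | cons {w : V} (e : E) (p : DPath s r (r e) w) : DPath s r (s e) w

/-- A Bratteli diagram: a directed graph with no sinks whose vertex set is partitioned
into finite levels `W_n = {v | level v = n}` (for `n ≥ 1`) such that every edge goes
from some level `n` to level `n + 1`, together with a degree function `d` taking
positive values and satisfying `d v ≥ ∑_{e ∈ E¹v} d (s e)` for every vertex `v`
(the sum being over the, necessarily finitely many, edges with range `v`). -/
structure BratteliDiagram where
  V : Type
  E : Type
  s : E → V
  r : E → V
  level : V → ℕ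
  d : V → ℕ
  level_pos : ∀ v, 1 ≤ level v
  level_finite : ∀ n, {v | level v = n}.Finite
  edge_level : ∀ e, level (r e) = level (s e) + 1
  no_sinks : ∀ v, ∃ e, s e = v
  d_pos : ∀ v, 0 < d v
  edges_to_finite : ∀ v, {e | r e = v}.Finite
  d_ge : ∀ v, ∑ᶠ e ∈ {e | r e = v}, d (s e) ≤ d v

/-- `∑_{α ∈ W_k E* v} d (s α)`: the sum of `d` over the sources of all paths with
range `v` and source in level `k` (the length-zero path at `v` being included when
`level v = k`). -/
noncomputable def levelPathSum (B : BratteliDiagram) (k : ℕ) (v : B.V) : ℕ :=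
  ∑ᶠ p ∈ {p : (u : B.V) × DPath B.s B.r u v | B.level p.1 = k}, B.d p.1

namespace BratteliDiagram

variable (B : BratteliDiagram)

/-- The sum of `d` over the sources of the edges with range `v`. -/
noncomputable def inDegree (v : B.V) : ℕ := ∑ᶠ e ∈ {e | B.r e = v}, B.d (B.s e)

/-- The paths with range `w` and source in level `k`. -/
def levelPaths (k : ℕ) (w : B.V) : Set ((u : B.V) × DPath B.s B.r u w) :=
  {p | B.level p.1 = k}

variable {B}

lemma level_le_of_path {u w : B.V} (p : DPath B.s B.r u w) : B.level u ≤ B.level w := by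
  induction p with
  | nil => exact le_rfl
  | cons e p ih => have := B.edge_level e; omega

lemma levelPaths_level_self (w : B.V) :
    B.levelPaths (B.level w) w = {⟨w, DPath.nil w⟩} := by
  ext ⟨u, p⟩
  constructor
  · intro hp
    change B.level u = B.level w at hp
    cases p with
    | nil => rfl
    | cons e p =>
      have := B.edge_level e
      have := level_le_of_path p
      omega
  · rintro ⟨⟩
    rfl

/-- A nontrivial path to `w`, split as its first edge and the remaining path. -/
abbrev SplitPath (w : B.V) : Type := (e : B.E) × DPath B.s B.r (B.r e) w

namespace SplitPath

variable {w : B.V}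

/-- The path obtained by putting the first edge back. -/
def toPath (y : SplitPath w) : (u : B.V) × DPath B.s B.r u w := ⟨B.s y.1, DPath.cons y.1 y.2⟩

/-- The path obtained by forgetting the first edge. -/
def tail (y : SplitPath w) : (u : B.V) × DPath B.s B.r u w := ⟨B.r y.1, y.2⟩

lemma toPath_injective : Function.Injective (toPath (w := w)) := by
  rintro ⟨e, p⟩ ⟨e', p'⟩ h
  let split : (u : B.V) × DPath B.s B.r u w → Option (SplitPath w) := fun x =>
    match x with
    | ⟨_, DPath.nil _⟩ => none
    | ⟨_, DPath.cons e p⟩ => some ⟨e, p⟩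
  exact Option.some.inj (congrArg split h)

lemma bijOn_fst_tail_fiber (q : (u : B.V) × DPath B.s B.r u w) :
    Set.BijOn Sigma.fst (tail ⁻¹' {q} : Set (SplitPath w)) {e | B.r e = q.1} := by
  refine ⟨?_, ?_, ?_⟩
  · rintro y rfl
    rfl
  · rintro ⟨e, p⟩ hp ⟨e', p'⟩ hp' (rfl : e = e')
    have h : tail ⟨e, p⟩ = tail ⟨e, p'⟩ := Eq.trans hp (Eq.symm hp')
    simpa [tail] using h
  · obtain ⟨u, p⟩ := q
    rintro e (rfl : B.r e = u)
    exact ⟨⟨e, p⟩, rfl, rfl⟩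

lemma finite_tail_fiber (q : (u : B.V) × DPath B.s B.r u w) :
    (tail ⁻¹' {q} : Set (SplitPath w)).Finite :=
  (bijOn_fst_tail_fiber q).finite_iff_finite.2 (B.edges_to_finite q.1)

end SplitPath

open SplitPath

lemma levelPaths_eq_image {k : ℕ} {w : B.V} (hk : k < B.level w) :
    B.levelPaths k w = toPath '' ⋃ q ∈ B.levelPaths (k + 1) w, tail ⁻¹' {q} := by
  ext ⟨u, p⟩
  constructor
  · intro hp
    change B.level u = k at hp
    cases p with
    | nil => omega
    | cons e p =>
      refine ⟨⟨e, p⟩, Set.mem_biUnion (x := tail ⟨e, p⟩) ?_ rfl, rfl⟩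
      change B.level (B.r e) = k + 1
      rw [B.edge_level, hp]
  · rintro ⟨⟨e, p'⟩, hy, h⟩
    simp only [Set.mem_iUnion] at hy
    obtain ⟨_, hq, rfl⟩ := hy
    change B.level (B.r e) = k + 1 at hq
    rw [← h]
    change B.level (B.s e) = k
    have := B.edge_level e
    omega

lemma finite_levelPaths {k : ℕ} {w : B.V} (hk : k ≤ B.level w) : (B.levelPaths k w).Finite := by
  induction hk using Nat.decreasingInduction with
  | self => rw [levelPaths_level_self]; exact Set.finite_singleton _
  | of_succ k hk ih =>
    rw [levelPaths_eq_image hk]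
    exact (ih.biUnion fun q _ => finite_tail_fiber q).image _

lemma levelPathSum_level_self (w : B.V) : levelPathSum B (B.level w) w = B.d w := by
  change ∑ᶠ p ∈ B.levelPaths (B.level w) w, B.d p.1 = _
  rw [levelPaths_level_self, finsum_mem_singleton]

lemma levelPathSum_eq_sum_inDegree {k : ℕ} {w : B.V} (hk : k < B.level w) :
    levelPathSum B k w = ∑ᶠ q ∈ B.levelPaths (k + 1) w, B.inDegree q.1 := by
  change ∑ᶠ p ∈ B.levelPaths k w, B.d p.1 = _
  rw [levelPaths_eq_image hk, finsum_mem_image toPath_injective.injOn,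
    finsum_mem_biUnion _ (finite_levelPaths hk) fun q _ => finite_tail_fiber q]
  · exact finsum_mem_congr rfl fun q _ =>
      finsum_mem_eq_of_bijOn Sigma.fst (bijOn_fst_tail_fiber q) fun _ _ => rfl
  · intro q _ q' _ hne
    exact Disjoint.preimage _ (Set.disjoint_singleton.2 hne)

lemma levelPathSum_le_succ {k : ℕ} {w : B.V} (hk : k < B.level w) :
    levelPathSum B k w ≤ levelPathSum B (k + 1) w := by
  have hfin := finite_levelPaths (B := B) (w := w) (k := k + 1) hk
  rw [levelPathSum_eq_sum_inDegree hk]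
  change _ ≤ ∑ᶠ q ∈ B.levelPaths (k + 1) w, B.d q.1
  rw [finsum_mem_eq_finite_toFinset_sum _ hfin, finsum_mem_eq_finite_toFinset_sum _ hfin]
  exact Finset.sum_le_sum fun q _ => B.d_ge q.1

lemma levelPathSum_mono {j k : ℕ} {w : B.V} (hjk : j ≤ k) (hk : k ≤ B.level w) :
    levelPathSum B j w ≤ levelPathSum B k w := by
  induction k, hjk using Nat.le_induction with
  | base => exact le_rfl
  | succ k _ ih => exact (ih (by omega)).trans (levelPathSum_le_succ hk)

lemma levelPathSum_lt_succ {v w : B.V} {k : ℕ} (p : DPath B.s B.r v w) (hv : B.level v = k + 1)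
    (hlt : B.inDegree v < B.d v) : levelPathSum B k w < levelPathSum B (k + 1) w := by
  have hk : k < B.level w := by have := level_le_of_path p; omega
  have hfin := finite_levelPaths (B := B) (w := w) (k := k + 1) hk
  rw [levelPathSum_eq_sum_inDegree hk]
  change _ < ∑ᶠ q ∈ B.levelPaths (k + 1) w, B.d q.1
  rw [finsum_mem_eq_finite_toFinset_sum _ hfin, finsum_mem_eq_finite_toFinset_sum _ hfin]
  exact Finset.sum_lt_sum (fun q _ => B.d_ge q.1) ⟨⟨v, p⟩, hfin.mem_toFinset.2 hv, hlt⟩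

end BratteliDiagram

/-!
STATEMENT 3 (second part of Lemma 4.2 of the paper).  Let `(E, d)` be a Bratteli diagram
with levels `W_n`.  Suppose every vertex `v` admits a vertex `w` with `v ≥ w` and
`d w = ∑_{α ∈ W₁ E* w} d (s α)`.  Then for every `n ≥ 2` and every `v ∈ W_n`,
`d v = ∑_{e ∈ E¹v} d (s e)`.
-/
theorem stmt_3 (B : BratteliDiagram)
    (h : ∀ v : B.V, ∃ w : B.V, Nonempty (DPath B.s B.r v w) ∧
      B.d w = levelPathSum B 1 w) :
    ∀ v : B.V, 2 ≤ B.level v → B.d v = ∑ᶠ e ∈ {e | B.r e = v}, B.d (B.s e) := by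
  intro v hv
  obtain ⟨w, ⟨p⟩, hw⟩ := h v
  by_contra hne
  obtain ⟨k, hk⟩ : ∃ k, B.level v = k + 1 := ⟨B.level v - 1, by omega⟩
  have hvw := BratteliDiagram.level_le_of_path p
  have hlt := BratteliDiagram.levelPathSum_lt_succ p hk
    (lt_of_le_of_ne (B.d_ge v) (Ne.symm hne))
  have h₁ := BratteliDiagram.levelPathSum_mono (B := B) (w := w) (j := 1) (k := k)
    (by omega) (by omega)
  have h₂ := BratteliDiagram.levelPathSum_mono (hk ▸ hvw : k + 1 ≤ B.level w) le_rfl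
  rw [BratteliDiagram.levelPathSum_level_self] at h₂
  omega
end

section
/- Let k ∈ ℕ, let (E, d) be a properly M_k-separated Bratteli diagram, and let G be the graph constructed from (E, d). Then for every v ∈ H, d(v) equals the number of paths α in G with r(α) = v, where the length-zero path at v is counted among these paths. -/
/-- An `M_k`-separated Bratteli diagram: the data of a distinguished vertex `y n` in each
level `W_n` (`n ≥ 1`), so that `W_n = H_n ⊔ {y n}` with `H_n = W_n \ {y n}`, such that
no edge goes from a vertex of `H_n` to `y (n+1)`, `d (y n) = k`, there is exactly one
edge from `y n` to `y (n+1)`, and there is at least one edge from `y n` to a vertex of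
`H_{n+1}`. -/
structure MkSeparated (B : BratteliDiagram) (k : ℕ) where
  y : ℕ → B.V
  y_level : ∀ n, 1 ≤ n → B.level (y n) = n
  no_H_to_y : ∀ n, 1 ≤ n → ∀ e : B.E, B.r e = y (n + 1) → B.s e = y n
  d_y : ∀ n, 1 ≤ n → B.d (y n) = k
  unique_y_to_y : ∀ n, 1 ≤ n → ∃! e : B.E, B.s e = y n ∧ B.r e = y (n + 1)
  y_to_H : ∀ n, 1 ≤ n → ∃ e : B.E, B.s e = y n ∧ B.r e ≠ y (n + 1)

/-- The complement `H = ⊔_{n ≥ 1} H_n` of the distinguished vertices of an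
`M_k`-separated Bratteli diagram. -/
def Hset (B : BratteliDiagram) {k : ℕ} (M : MkSeparated B k) : Set B.V :=
  {v | v ≠ M.y (B.level v)}

/-- The sum `∑_{e ∈ E¹v} d (s e)` over the edges with range `v`. -/
noncomputable def inDeg (B : BratteliDiagram) (v : B.V) : ℕ :=
  ∑ᶠ e ∈ {e | B.r e = v}, B.d (B.s e)

/-- `δ v = d v − ∑_{e ∈ E¹v} d (s e) − 1`. -/
noncomputable def deltaNum (B : BratteliDiagram) (v : B.V) : ℕ :=
  B.d v - inDeg B v - 1

/-- `m v`: the number of edges of `E` from `y (level v − 1)` to `v` (this is `0` for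
`v ∈ H₁`, since no edge ends at level `1`). -/
noncomputable def mNum (B : BratteliDiagram) {k : ℕ} (M : MkSeparated B k) (v : B.V) : ℕ :=
  Nat.card {e : B.E // B.s e = M.y (B.level v - 1) ∧ B.r e = v}

/-- In an `M_k`-separated Bratteli diagram, `k > 0` (since `k = d (y 1) > 0`). -/
theorem k_pos (B : BratteliDiagram) (k : ℕ) (M : MkSeparated B k) : 0 < k := by
  have h1 := B.d_pos (M.y 1)
  rwa [M.d_y 1 le_rfl] at h1

/-- Vertex set of the graph `G` constructed from a properly `M_k`-separated Bratteli
diagram: `H ⊔ {z₁, …, z_k} ⊔ {x_i^v : v ∈ H, 1 ≤ i ≤ δ v}`. -/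
noncomputable def GV (B : BratteliDiagram) (k : ℕ) (M : MkSeparated B k) : Type :=
  {v : B.V // v ∈ Hset B M} ⊕ {i : ℕ // 1 ≤ i ∧ i ≤ k} ⊕
    (Σ v : {v : B.V // v ∈ Hset B M}, {i : ℕ // 1 ≤ i ∧ i ≤ deltaNum B v.1})

/-- Edge set of the graph `G`: all edges of `E` with source and range in `H`, edges
`e_i` (`1 ≤ i ≤ k−1`) from `z_i` to `z_k`, edges `f_i^v` (`1 ≤ i ≤ m v`) from `z_k`
to `v ∈ H`, and edges `g_i^v` (`1 ≤ i ≤ δ v`) from `x_i^v` to `v ∈ H`. -/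
noncomputable def GE (B : BratteliDiagram) (k : ℕ) (M : MkSeparated B k) : Type :=
  {e : B.E // B.s e ∈ Hset B M ∧ B.r e ∈ Hset B M} ⊕
  {i : ℕ // 1 ≤ i ∧ i ≤ k - 1} ⊕
  (Σ v : {v : B.V // v ∈ Hset B M}, {i : ℕ // 1 ≤ i ∧ i ≤ mNum B M v.1}) ⊕
  (Σ v : {v : B.V // v ∈ Hset B M}, {i : ℕ // 1 ≤ i ∧ i ≤ deltaNum B v.1})

/-- The vertex `z_k` of `G`. -/
noncomputable def zk (B : BratteliDiagram) (k : ℕ) (M : MkSeparated B k) : GV B k M :=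
  Sum.inr (Sum.inl ⟨k, k_pos B k M, le_rfl⟩)

/-- The source map of the graph `G`. -/
noncomputable def gs (B : BratteliDiagram) (k : ℕ) (M : MkSeparated B k) :
    GE B k M → GV B k M
  | Sum.inl e => Sum.inl ⟨B.s e.1, e.2.1⟩
  | Sum.inr (Sum.inl i) =>
      Sum.inr (Sum.inl ⟨i.1, i.2.1, le_trans i.2.2 (Nat.sub_le k 1)⟩)
  | Sum.inr (Sum.inr (Sum.inl _)) => zk B k M
  | Sum.inr (Sum.inr (Sum.inr p)) => Sum.inr (Sum.inr p)

/-- The range map of the graph `G`. -/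
noncomputable def gr (B : BratteliDiagram) (k : ℕ) (M : MkSeparated B k) :
    GE B k M → GV B k M
  | Sum.inl e => Sum.inl ⟨B.r e.1, e.2.2⟩
  | Sum.inr (Sum.inl _) => zk B k M
  | Sum.inr (Sum.inr (Sum.inl p)) => Sum.inl p.1
  | Sum.inr (Sum.inr (Sum.inr p)) => Sum.inl p.1

namespace DPath

variable {V E : Type} {s r : E → V}

/-- The path obtained by appending the edge `e` to a path ending at the source of `e`. -/
def snoc {u w : V} (p : DPath s r u w) (e : E) (h : s e = w) : DPath s r u (r e) :=
  match p with
  | nil _ => h ▸ cons e (nil (r e))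
  | cons e' q => cons e' (q.snoc e h)

/-- Splitting off the last edge of a path. -/
def unsnoc {u w : V} : DPath s r u w →
    PLift (u = w) ⊕ (Σ e : {e : E // r e = w}, DPath s r u (s e.1))
  | nil _ => Sum.inl ⟨rfl⟩
  | cons e p =>
    match p.unsnoc with
    | Sum.inl h => Sum.inr ⟨⟨e, h.down⟩, nil (s e)⟩
    | Sum.inr q => Sum.inr ⟨q.1, cons e q.2⟩

/-- The inverse of `DPath.unsnoc`. -/
def ofUnsnoc {u w : V} :
    PLift (u = w) ⊕ (Σ e : {e : E // r e = w}, DPath s r u (s e.1)) → DPath s r u w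
  | Sum.inl h => h.down ▸ nil u
  | Sum.inr q => q.1.2 ▸ q.2.snoc q.1.1 rfl

theorem ofUnsnoc_unsnoc {u w : V} (p : DPath s r u w) : ofUnsnoc p.unsnoc = p := by
  induction p with
  | nil v => rfl
  | cons e p ih =>
    rw [unsnoc]
    rcases hp : p.unsnoc with ⟨⟨h⟩⟩ | ⟨⟨e', rfl⟩, q⟩
    · rw [hp] at ih
      subst h
      rw [← ih]
      rfl
    · rw [hp] at ih
      rw [← ih]
      rfl

theorem unsnoc_snoc {u w : V} (p : DPath s r u w) (e : E) (h : s e = w) :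
    (p.snoc e h).unsnoc = Sum.inr ⟨⟨e, rfl⟩, h ▸ p⟩ := by
  induction p with
  | nil v => subst h; rfl
  | cons e' q ih =>
    subst h
    rw [snoc, unsnoc, ih rfl]

theorem unsnoc_ofUnsnoc {u w : V}
    (q : PLift (u = w) ⊕ (Σ e : {e : E // r e = w}, DPath s r u (s e.1))) :
    (ofUnsnoc q).unsnoc = q := by
  rcases q with ⟨⟨rfl⟩⟩ | ⟨⟨e, rfl⟩, p⟩
  · rfl
  · exact unsnoc_snoc p e rfl

/-- A path is either trivial or consists of a last edge and a path to the source of that edge. -/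
def unsnocEquiv (u w : V) :
    DPath s r u w ≃ PLift (u = w) ⊕ (Σ e : {e : E // r e = w}, DPath s r u (s e.1)) where
  toFun := unsnoc
  invFun := ofUnsnoc
  left_inv := ofUnsnoc_unsnoc
  right_inv := unsnoc_ofUnsnoc

variable (s r) in
/-- Paths with range `w`. -/
abbrev Ending (w : V) : Type := (u : V) × DPath s r u w

/-- A path with range `w` is either trivial or consists of a last edge and a path ending at the
source of that edge. -/
def endingEquiv (w : V) :
    Ending s r w ≃ Unit ⊕ (Σ e : {e : E // r e = w}, Ending s r (s e.1)) :=
  (Equiv.sigmaCongrRight fun u => unsnocEquiv u w).trans <|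
    (Equiv.sigmaSumDistrib _ _).trans <|
      Equiv.sumCongr
        { toFun := fun _ => ()
          invFun := fun _ => ⟨w, ⟨rfl⟩⟩
          left_inv := by rintro ⟨_, ⟨rfl⟩⟩; rfl
          right_inv := fun _ => rfl }
        { toFun := fun x => ⟨x.2.1, x.1, x.2.2⟩
          invFun := fun x => ⟨x.2.1, x.1, x.2.2⟩
          left_inv := fun _ => rfl
          right_inv := fun _ => rfl }

/-- If finitely many edges, indexed by `ι`, end at `w`, then the number of paths ending at `w` is
one more than the total number of paths ending at the sources of these edges. -/
theorem finite_and_card_ending {w : V} {ι : Type} [Fintype ι] (f : ι ≃ {e : E // r e = w})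
    (n : ι → ℕ)
    (h : ∀ i, Finite (Ending s r (s (f i).1)) ∧ Nat.card (Ending s r (s (f i).1)) = n i) :
    Finite (Ending s r w) ∧ Nat.card (Ending s r w) = 1 + ∑ i, n i := by
  have (i : ι) := (h i).1
  let g : Ending s r w ≃ Unit ⊕ (Σ i, Ending s r (s (f i).1)) :=
    (endingEquiv w).trans (Equiv.sumCongr (Equiv.refl _)
      (Equiv.sigmaCongrLeft (β := fun e => Ending s r (s e.1)) f).symm)
  refine ⟨Finite.of_equiv _ g.symm, ?_⟩
  rw [Nat.card_congr g, Nat.card_sum, Nat.card_sigma]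
  simp [(h _).2]

/-- The trivial path is the only path ending at a vertex that receives no edge. -/
theorem finite_and_card_ending_of_source {w : V} (h : ∀ e, r e ≠ w) :
    Finite (Ending s r w) ∧ Nat.card (Ending s r w) = 1 := by
  have : IsEmpty {e : E // r e = w} := ⟨fun e => h e.1 e.2⟩
  simpa using finite_and_card_ending (s := s) (Equiv.equivOfIsEmpty Empty {e : E // r e = w})
    (fun _ => 0) (fun i => i.elim)

end DPath

theorem Nat.card_one_le_le (n : ℕ) : Nat.card {i : ℕ // 1 ≤ i ∧ i ≤ n} = n := by
  simpa using Nat.subtype_card (Finset.Icc 1 n) fun _ => Finset.mem_Icc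

section ConstructedGraph

open DPath

variable (B : BratteliDiagram) (k : ℕ) (M : MkSeparated B k)

instance instFintypeOneLeLe (n : ℕ) : Fintype {i : ℕ // 1 ≤ i ∧ i ≤ n} :=
  Fintype.subtype (Finset.Icc 1 n) fun _ => Finset.mem_Icc

theorem finite_and_card_ending_x
    (x : Σ v : {v : B.V // v ∈ Hset B M}, {i : ℕ // 1 ≤ i ∧ i ≤ deltaNum B v.1}) :
    Finite (Ending (gs B k M) (gr B k M) (Sum.inr (Sum.inr x))) ∧
      Nat.card (Ending (gs B k M) (gr B k M) (Sum.inr (Sum.inr x))) = 1 := by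
  apply finite_and_card_ending_of_source
  rintro (e | e | e | e) h <;> cases h

theorem finite_and_card_ending_z (i : {i : ℕ // 1 ≤ i ∧ i ≤ k}) (hi : i.1 < k) :
    Finite (Ending (gs B k M) (gr B k M) (Sum.inr (Sum.inl i))) ∧
      Nat.card (Ending (gs B k M) (gr B k M) (Sum.inr (Sum.inl i))) = 1 := by
  apply finite_and_card_ending_of_source
  rintro (e | e | e | e) h <;> cases h
  exact lt_irrefl _ hi

/-- The edges of `G` ending at `z_k`. -/
noncomputable def edgesToZk :
    {i : ℕ // 1 ≤ i ∧ i ≤ k - 1} ≃ {e : GE B k M // gr B k M e = zk B k M} where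
  toFun i := ⟨Sum.inr (Sum.inl i), rfl⟩
  invFun
    | ⟨Sum.inr (Sum.inl i), _⟩ => i
    | ⟨Sum.inl _, h⟩ => by cases h
    | ⟨Sum.inr (Sum.inr (Sum.inl _)), h⟩ => by cases h
    | ⟨Sum.inr (Sum.inr (Sum.inr _)), h⟩ => by cases h
  left_inv _ := rfl
  right_inv := by rintro ⟨e | e | e | e, h⟩ <;> first | rfl | cases h

theorem finite_and_card_ending_zk :
    Finite (Ending (gs B k M) (gr B k M) (zk B k M)) ∧
      Nat.card (Ending (gs B k M) (gr B k M) (zk B k M)) = k := by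
  have hk := k_pos B k M
  have key := finite_and_card_ending (edgesToZk B k M) (fun _ => 1) fun i =>
    finite_and_card_ending_z B k M ⟨i.1, i.2.1, i.2.2.trans (Nat.sub_le k 1)⟩
      (by have := i.2; dsimp only; omega)
  refine ⟨key.1, key.2.trans ?_⟩
  rw [Finset.sum_const, Finset.card_univ, ← Nat.card_eq_fintype_card, Nat.card_one_le_le,
    smul_eq_mul]
  omega

variable {B k M}

/-- The edges of `G` ending at a vertex `v` of `H`. -/
noncomputable def edgesToH (v : {v : B.V // v ∈ Hset B M}) :
    {e : {e : B.E // B.r e = v.1} // B.s e.1 ∈ Hset B M} ⊕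
      {i : ℕ // 1 ≤ i ∧ i ≤ mNum B M v.1} ⊕ {i : ℕ // 1 ≤ i ∧ i ≤ deltaNum B v.1} ≃
    {e : GE B k M // gr B k M e = Sum.inl v} :=
  Equiv.ofBijective
    (fun
      | Sum.inl e => ⟨Sum.inl ⟨e.1.1, e.2, by rw [e.1.2]; exact v.2⟩,
          congrArg Sum.inl (Subtype.ext e.1.2)⟩
      | Sum.inr (Sum.inl i) => ⟨Sum.inr (Sum.inr (Sum.inl ⟨v, i⟩)), rfl⟩
      | Sum.inr (Sum.inr i) => ⟨Sum.inr (Sum.inr (Sum.inr ⟨v, i⟩)), rfl⟩) <| by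
    constructor
    · rintro (⟨⟨e, he⟩, he'⟩ | i | i) (⟨⟨e₂, he₂⟩, he₂'⟩ | j | j) h <;> cases h <;> rfl
    · rintro ⟨e | e | ⟨w, i⟩ | ⟨w, i⟩, h⟩
      · exact ⟨Sum.inl ⟨⟨e.1, congrArg Subtype.val (Sum.inl.inj h)⟩, e.2.1⟩, rfl⟩
      · cases h
      · cases h
        exact ⟨Sum.inr (Sum.inl i), rfl⟩
      · cases h
        exact ⟨Sum.inr (Sum.inr i), rfl⟩

/-- The sources of edges ending at `v` that lie outside `H` are the distinguished vertex of the
preceding level. -/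
theorem source_notMem_Hset_iff {v : B.V} (e : {e : B.E // B.r e = v}) :
    B.s e.1 ∉ Hset B M ↔ B.s e.1 = M.y (B.level v - 1) := by
  have h := B.edge_level e.1
  rw [e.2] at h
  simp [Hset, h]

open Classical in
theorem inDeg_eq_sum_add (v : B.V) [Fintype {e : B.E // B.r e = v}] :
    inDeg B v = (∑ e : {e : {e : B.E // B.r e = v} // B.s e.1 ∈ Hset B M}, B.d (B.s e.1.1)) +
      mNum B M v * k := by
  have h : inDeg B v = ∑ e : {e : B.E // B.r e = v}, B.d (B.s e.1) := by
    rw [inDeg, ← finsum_set_coe_eq_finsum_mem]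
    exact finsum_eq_sum_of_fintype fun e : {e : B.E // B.r e = v} => B.d (B.s e.1)
  rw [h, ← Fintype.sum_subtype_add_sum_subtype (fun e => B.s e.1 ∈ Hset B M)]
  congr 1
  have hd (e : {e : {e : B.E // B.r e = v} // B.s e.1 ∉ Hset B M}) : B.d (B.s e.1.1) = k := by
    have hy : B.s e.1.1 = M.y (B.level (B.s e.1.1)) := not_not.mp e.2
    rw [hy]
    exact M.d_y _ (B.level_pos _)
  rw [Finset.sum_congr rfl fun e _ => hd e, Finset.sum_const, Finset.card_univ,
    ← Nat.card_eq_fintype_card, smul_eq_mul, mNum]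
  congr 1
  exact Nat.card_congr <| (Equiv.subtypeEquivRight source_notMem_Hset_iff).trans <|
    (Equiv.subtypeSubtypeEquivSubtypeInter _ fun e => B.s e = M.y (B.level v - 1)).trans <|
      Equiv.subtypeEquivRight fun _ => and_comm

theorem finite_and_card_ending_H (hproper : ∀ v ∈ Hset B M, inDeg B v < B.d v)
    (v : B.V) (hv : v ∈ Hset B M) :
    Finite (Ending (gs B k M) (gr B k M) (Sum.inl ⟨v, hv⟩)) ∧
      Nat.card (Ending (gs B k M) (gr B k M) (Sum.inl ⟨v, hv⟩)) = B.d v := by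
  classical
  induction hn : B.level v using Nat.strong_induction_on generalizing v with
  | _ n ih =>
    have : Fintype {e : B.E // B.r e = v} := (B.edges_to_finite v).fintype
    have key := finite_and_card_ending (s := gs B k M) (edgesToH ⟨v, hv⟩)
      (Sum.elim (fun e => B.d (B.s e.1.1)) (Sum.elim (fun _ => k) fun _ => 1)) (by
        rintro (e | i | i)
        · refine ih _ ?_ _ e.2 rfl
          have h := B.edge_level e.1.1
          rw [e.1.2] at h
          dsimp only at h
          omega
        · exact finite_and_card_ending_zk B k M
        · exact finite_and_card_ending_x B k M _)
    refine ⟨key.1, key.2.trans ?_⟩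
    have hlt := hproper v hv
    have hsum := inDeg_eq_sum_add (M := M) v
    simp only [Fintype.sum_sum_type, Sum.elim_inl, Sum.elim_inr, Finset.sum_const,
      Finset.card_univ, ← Nat.card_eq_fintype_card, Nat.card_one_le_le, smul_eq_mul, mul_one]
    rw [deltaNum]
    omega

end ConstructedGraph

/-!
STATEMENT 7 (Lemma 5.3 of the paper).  Let `(E, d)` be a properly `M_k`-separated
Bratteli diagram (so `d v > ∑_{e ∈ E¹v} d (s e)` for every `v ∈ H`) and let `G` be the
graph constructed from `(E, d)`.  Then for every `v ∈ H`, `d v` equals the number of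
paths `α` in `G` with `r α = v`, the length-zero path at `v` being counted among them.
-/
theorem stmt_7 (B : BratteliDiagram) (k : ℕ) (M : MkSeparated B k)
    (hproper : ∀ v ∈ Hset B M, inDeg B v < B.d v)
    (v : B.V) (hv : v ∈ Hset B M) :
    B.d v = Nat.card
      ((u : GV B k M) × DPath (gs B k M) (gr B k M) u (Sum.inl ⟨v, hv⟩)) := by
  exact (finite_and_card_ending_H hproper v hv).2.symm
end
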